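/- arXiv:1107.2871 — 2 statements merged into one kernel-verified Lean document; each statement's English description precedes it below -/
import Mathlib

section
/- (Lemmas 5.1 and 5.2.) Under the stated hypotheses, every entry b_i^j is nonnegative and nondecreasing in t, every entry a_i^j is nonnegative, and every entry of a and of b is right-continuous on [0,∞) with left limits on (0,∞). -/
open Set Filter

/-- `(y, z)` solves the Skorohod problem for `x` with reflection matrix `R`. -/
def SolvesSkorohod (J : ℕ) (R : Matrix (Fin J) (Fin J) ℝ)
    (x y z : ℝ → Fin J → ℝ) : Prop :=
  (∀ i, ContinuousOn (fun t => y t i) (Set.Ici 0)) ∧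
  (∀ i, ContinuousOn (fun t => z t i) (Set.Ici 0)) ∧
  (∀ t ≥ (0 : ℝ), ∀ i, z t i = x t i + ∑ k, R i k * y t k) ∧
  (∀ t ≥ (0 : ℝ), ∀ i, 0 ≤ z t i) ∧
  (∀ i, y 0 i = 0) ∧
  (∀ i, ∀ s t : ℝ, 0 ≤ s → s ≤ t → y s i ≤ y t i) ∧
  (∀ i, ∀ u v : ℝ, 0 ≤ u → u ≤ v → (∀ s ∈ Set.Icc u v, 0 < z s i) → y v i = y u i)

open scoped Topology NNReal ENNReal Matrix

/-- In a complex Banach algebra, powers of an element whose spectrum lies in the open unit disc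
tend to zero. -/
theorem tendsto_pow_zero_of_spectrum_lt_one {A : Type*} [NormedRing A] [NormedAlgebra ℂ A]
    [CompleteSpace A] [Nontrivial A] (a : A) (ha : ∀ μ ∈ spectrum ℂ a, ‖μ‖ < 1) :
    Tendsto (fun n : ℕ => a ^ n) atTop (𝓝 0) := by
  have hρ : spectralRadius ℂ a < (1 : ℝ≥0) :=
    spectrum.spectralRadius_lt_of_forall_lt a fun μ hμ => by
      rw [← NNReal.coe_lt_coe]
      simpa using ha μ hμ
  obtain ⟨r, hρr, hr⟩ := ENNReal.lt_iff_exists_nnreal_btwn.1 hρ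
  have hr1 : r < 1 := by exact_mod_cast hr
  refine squeeze_zero_norm' (a := fun n : ℕ => (r : ℝ) ^ n) ?_
    (tendsto_pow_atTop_nhds_zero_of_lt_one r.2 (by exact_mod_cast hr1))
  have hlim := spectrum.pow_nnnorm_pow_one_div_tendsto_nhds_spectralRadius a
  filter_upwards [hlim.eventually_lt_const hρr, eventually_gt_atTop 0] with n hn hn0
  have hnpos : (0 : ℝ) < n := by exact_mod_cast hn0
  have h1 : (‖a ^ n‖₊ : ℝ≥0∞) ≤ (r : ℝ≥0∞) ^ n := by
    have h2 := ENNReal.rpow_le_rpow hn.le hnpos.le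
    rwa [← ENNReal.rpow_mul, one_div, inv_mul_cancel₀ hnpos.ne', ENNReal.rpow_one,
      ENNReal.rpow_natCast] at h2
  have h3 : ‖a ^ n‖₊ ≤ r ^ n := by exact_mod_cast h1
  exact_mod_cast h3

section MatrixPowers

attribute [local instance] Matrix.linftyOpNormedRing Matrix.linftyOpNormedAlgebra

/-- The entries of the powers of a real matrix of spectral radius less than one tend to zero. -/
theorem tendsto_matrix_pow_apply_zero {J : ℕ} (P : Matrix (Fin J) (Fin J) ℝ)
    (hP : ∀ μ ∈ spectrum ℂ (P.map (Complex.ofReal ·)), ‖μ‖ < 1) (i k : Fin J) :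
    Tendsto (fun n : ℕ => (P ^ n) i k) atTop (𝓝 0) := by
  have : Nonempty (Fin J) := ⟨i⟩
  have h := tendsto_pow_zero_of_spectrum_lt_one _ hP
  have h1 : Tendsto (fun n : ℕ => (P.map (Complex.ofReal ·) ^ n) i k) atTop (𝓝 0) :=
    ((continuous_id.matrix_elem i k).tendsto (0 : Matrix (Fin J) (Fin J) ℂ)).comp h
  have h2 := (Complex.continuous_re.tendsto 0).comp h1
  rw [Complex.zero_re] at h2
  refine h2.congr fun n => ?_
  have h3 : P.map (Complex.ofReal ·) ^ n = (P ^ n).map (Complex.ofReal ·) :=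
    (map_pow (Complex.ofRealHom.mapMatrix (m := Fin J)) P n).symm
  simp [h3]

end MatrixPowers

/-- A vector dominated by `P ^ n *ᵥ c` for all `n` is nonpositive if `P ^ n` tends to zero. -/
theorem nonpos_of_forall_le_pow_mulVec {J : ℕ} {P : Matrix (Fin J) (Fin J) ℝ}
    (hP : ∀ i k, Tendsto (fun n : ℕ => (P ^ n) i k) atTop (𝓝 0)) {q : ℝ} (c : Fin J → ℝ)
    (i : Fin J) (h : ∀ n : ℕ, q ≤ (P ^ n *ᵥ c) i) : q ≤ 0 := by
  have hlim := tendsto_finsetSum Finset.univ fun k _ => (hP i k).mul_const (c k)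
  simp only [zero_mul, Finset.sum_const_zero] at hlim
  exact ge_of_tendsto' hlim h

theorem mulVec_mono {J : ℕ} {P : Matrix (Fin J) (Fin J) ℝ} (hP : ∀ i k, 0 ≤ P i k)
    {u v : Fin J → ℝ} (h : ∀ k, u k ≤ v k) (i : Fin J) : (P *ᵥ u) i ≤ (P *ᵥ v) i :=
  Finset.sum_le_sum (s := Finset.univ) fun k _ => mul_le_mul_of_nonneg_left (h k) (hP i k)

theorem pow_mulVec_nonneg {J : ℕ} {P : Matrix (Fin J) (Fin J) ℝ} (hP : ∀ i k, 0 ≤ P i k)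
    {c : Fin J → ℝ} (hc : ∀ k, 0 ≤ c k) (n : ℕ) : ∀ i, 0 ≤ (P ^ n *ᵥ c) i := by
  induction n with
  | zero => simpa using hc
  | succ n ih =>
    intro i
    rw [pow_succ', ← Matrix.mulVec_mulVec]
    exact Finset.sum_nonneg (s := Finset.univ) fun k _ => mul_nonneg (hP i k) (ih k)

namespace SolvesSkorohod

variable {J : ℕ} {R P : Matrix (Fin J) (Fin J) ℝ} {x x' y y' z z' : ℝ → Fin J → ℝ}

theorem y_nonneg (h : SolvesSkorohod J R x y z) {t : ℝ} (ht : 0 ≤ t) (i : Fin J) : 0 ≤ y t i := by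
  obtain ⟨-, -, -, -, h0, hmono, -⟩ := h
  simpa [h0 i] using hmono i 0 t le_rfl ht

theorem z_eq (h : SolvesSkorohod J (1 - P) x y z) {t : ℝ} (ht : 0 ≤ t) (i : Fin J) :
    z t i = x t i + (y t i - (P *ᵥ y t) i) := by
  rw [h.2.2.1 t ht i]
  congr 1
  change ((1 - P) *ᵥ y t) i = _
  simp [Matrix.sub_mulVec]

/-- The regulator is zero, or its value was attained at an earlier zero of the reflected path. -/
theorem y_eq_zero_or_exists (h : SolvesSkorohod J R x y z) {t : ℝ} (ht : 0 ≤ t) (i : Fin J) :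
    y t i = 0 ∨ ∃ τ, 0 ≤ τ ∧ τ ≤ t ∧ z τ i = 0 ∧ y τ i = y t i := by
  obtain ⟨hyc, hzc, -, hz, h0, -, hconst⟩ := h
  by_cases hne : ∃ s ∈ Icc 0 t, z s i = 0
  · right
    have hcomp : IsCompact (Icc 0 t ∩ (fun s => z s i) ⁻¹' {0}) :=
      isCompact_Icc.of_isClosed_subset
        (((hzc i).mono Icc_subset_Ici_self).preimage_isClosed_of_isClosed isClosed_Icc
          isClosed_singleton) inter_subset_left
    obtain ⟨τ, ⟨⟨hτ0, hτt⟩, hzτ⟩, hτ⟩ := hcomp.exists_isGreatest hne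
    refine ⟨τ, hτ0, hτt, hzτ, ?_⟩
    rcases hτt.eq_or_lt with rfl | hlt
    · rfl
    have hc : Tendsto (fun s => y s i) (𝓝[>] τ) (𝓝 (y τ i)) :=
      ((hyc i) τ hτ0).mono fun s hs => hτ0.trans (le_of_lt hs)
    refine tendsto_nhds_unique hc (tendsto_const_nhds.congr' ?_)
    filter_upwards [Ioc_mem_nhdsGT hlt] with u hu
    refine hconst i u t (hτ0.trans hu.1.le) hu.2 fun s hs => ?_
    have hs0 : 0 ≤ s := hτ0.trans (hu.1.le.trans hs.1)
    refine (hz s hs0 i).lt_of_ne' fun hzs => ?_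
    exact absurd (hτ ⟨⟨hs0, hs.2⟩, hzs⟩) (not_le.2 (hu.1.trans_le hs.1))
  · left
    push Not at hne
    rw [hconst i 0 t le_rfl ht fun s hs => (hz s hs.1 i).lt_of_ne' (hne s hs), h0]

/-- The regulator is the least nonnegative nondecreasing function that keeps the path
nonnegative. -/
theorem y_le_of_feasible (hP : ∀ i k, 0 ≤ P i k)
    (hP0 : ∀ i k, Tendsto (fun n : ℕ => (P ^ n) i k) atTop (𝓝 0))
    (h : SolvesSkorohod J (1 - P) x y z) (hnn : ∀ t ≥ (0 : ℝ), ∀ i, 0 ≤ y' t i)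
    (hmono : ∀ i, ∀ s t : ℝ, 0 ≤ s → s ≤ t → y' s i ≤ y' t i)
    (hfeas : ∀ t ≥ (0 : ℝ), ∀ i, 0 ≤ x t i + (y' t i - (P *ᵥ y' t) i))
    {t : ℝ} (ht : 0 ≤ t) (i : Fin J) : y t i ≤ y' t i := by
  have key : ∀ n : ℕ, ∀ s, 0 ≤ s → s ≤ t → ∀ i, y s i - y' s i ≤ (P ^ n *ᵥ y t) i := by
    intro n
    induction n with
    | zero =>
      intro s hs hst i
      have := h.2.2.2.2.2.1 i s t hs hst
      have := hnn s hs i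
      simp only [pow_zero, Matrix.one_mulVec]
      linarith
    | succ n ih =>
      intro s hs hst i
      rcases h.y_eq_zero_or_exists hs i with h0 | ⟨τ, hτ0, hτs, hzτ, hyτ⟩
      · have := pow_mulVec_nonneg hP (fun k => h.y_nonneg ht k) (n + 1) i
        have := hnn s hs i
        linarith
      · have h1 := mulVec_mono hP (ih τ hτ0 (hτs.trans hst)) i
        rw [Matrix.mulVec_mulVec, ← pow_succ'] at h1
        have h2 : (P *ᵥ fun k => y τ k - y' τ k) i = (P *ᵥ y τ) i - (P *ᵥ y' τ) i :=
          congrFun (Matrix.mulVec_sub P (y τ) (y' τ)) i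
        have h3 := h.z_eq hτ0 i
        have h4 := hfeas τ hτ0 i
        have h5 := hmono i τ s hτ0 hτs
        linarith
  have := nonpos_of_forall_le_pow_mulVec hP0 (y t) i fun n => key n t ht le_rfl i
  linarith

/-- The amount by which the regulator for `x'` exceeds its predecessor is at most the largest past
value of the difference of the free terms. -/
theorem exists_y_sub_le (h : SolvesSkorohod J (1 - P) x y z)
    (h' : SolvesSkorohod J (1 - P) x' y' z') (h0 : ∀ i, x' 0 i = x 0 i) {s : ℝ}
    (hs : 0 ≤ s) (i : Fin J) :
    ∃ σ, 0 ≤ σ ∧ σ ≤ s ∧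
      y' s i - y s i ≤ x σ i - x' σ i + (P *ᵥ fun k => y' σ k - y σ k) i := by
  rcases h'.y_eq_zero_or_exists hs i with hy | ⟨σ, hσ0, hσs, hzσ, hyσ⟩
  · refine ⟨0, le_rfl, hs, ?_⟩
    have := h.y_nonneg hs i
    have hw : (fun k => y' 0 k - y 0 k) = 0 := by
      funext k
      simp [h.2.2.2.2.1 k, h'.2.2.2.2.1 k]
    rw [hw, Matrix.mulVec_zero, Pi.zero_apply, h0 i]
    linarith
  · refine ⟨σ, hσ0, hσs, ?_⟩
    have h2 : (P *ᵥ fun k => y' σ k - y σ k) i = (P *ᵥ y' σ) i - (P *ᵥ y σ) i :=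
      congrFun (Matrix.mulVec_sub P (y' σ) (y σ)) i
    have h3 := h.z_eq hσ0 i
    have h4 := h'.z_eq hσ0 i
    have h5 := h.2.2.2.1 σ hσ0 i
    have h6 := h.2.2.2.2.2.1 i σ s hσ0 hσs
    linarith

/-- If `x - x'` is nondecreasing and starts at zero, so does the difference of the regulators. -/
theorem monotone_y_sub (hP : ∀ i k, 0 ≤ P i k)
    (hP0 : ∀ i k, Tendsto (fun n : ℕ => (P ^ n) i k) atTop (𝓝 0))
    (h : SolvesSkorohod J (1 - P) x y z) (h' : SolvesSkorohod J (1 - P) x' y' z')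
    (h0 : ∀ i, x' 0 i = x 0 i)
    (hx : ∀ i, ∀ s t : ℝ, 0 ≤ s → s ≤ t → x s i - x' s i ≤ x t i - x' t i)
    (i : Fin J) {s t : ℝ} (hs : 0 ≤ s) (hst : s ≤ t) : y' s i - y s i ≤ y' t i - y t i := by
  have key : ∀ n : ℕ, ∀ u v, 0 ≤ u → u ≤ v → v ≤ t → ∀ i,
      (y' u i - y u i) - (y' v i - y v i) ≤ (P ^ n *ᵥ y t) i := by
    intro n
    induction n with
    | zero =>
      intro u v hu huv hvt i
      have := h'.2.2.2.2.2.1 i u v hu huv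
      have := h.2.2.2.2.2.1 i v t (hu.trans huv) hvt
      have := h.y_nonneg hu i
      simp only [pow_zero, Matrix.one_mulVec]
      linarith
    | succ n ih =>
      intro u v hu huv hvt i
      have hv := hu.trans huv
      have hpos := pow_mulVec_nonneg hP (fun k => h.y_nonneg (hv.trans hvt) k) (n + 1) i
      have hy' := h'.2.2.2.2.2.1 i u v hu huv
      have hy := h.2.2.2.2.2.1 i u v hu huv
      by_cases heq : y v i ≤ y u i
      · linarith
      rcases h.y_eq_zero_or_exists hv i with hyv | ⟨τ, hτ0, hτv, hzτ, hyτ⟩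
      · exact absurd (hyv.le.trans (h.y_nonneg hu i)) heq
      have huτ : u ≤ τ := by
        by_contra! hτu
        exact heq (hyτ ▸ h.2.2.2.2.2.1 i τ u hτ0 hτu.le)
      obtain ⟨σ, hσ0, hσu, hσ⟩ := exists_y_sub_le h h' h0 hu i
      have h1 := mulVec_mono hP (ih σ τ hσ0 (hσu.trans huτ) (hτv.trans hvt)) i
      rw [Matrix.mulVec_mulVec, ← pow_succ'] at h1
      have h2 : (P *ᵥ fun k => (y' σ k - y σ k) - (y' τ k - y τ k)) i
          = (P *ᵥ fun k => y' σ k - y σ k) i - ((P *ᵥ y' τ) i - (P *ᵥ y τ) i) := by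
        rw [← Pi.sub_apply (P *ᵥ y' τ), ← Matrix.mulVec_sub]
        exact congrFun (Matrix.mulVec_sub P (fun k => y' σ k - y σ k) (y' τ - y τ)) i
      have h3 := h.z_eq hτ0 i
      have h4 := h'.z_eq hτ0 i
      have h5 := h'.2.2.2.1 τ hτ0 i
      have h6 := h'.2.2.2.2.2.1 i τ v hτ0 hτv
      have h7 := hx i σ τ hσ0 (hσu.trans huτ)
      linarith
  have := nonpos_of_forall_le_pow_mulVec hP0 (y t) i fun n => key n s t hs hst le_rfl i
  linarith

/-- If `x - x'` is nondecreasing and starts at zero, the reflected path of `x'` is the smaller. -/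
theorem z_le_z (hP : ∀ i k, 0 ≤ P i k)
    (hP0 : ∀ i k, Tendsto (fun n : ℕ => (P ^ n) i k) atTop (𝓝 0))
    (h : SolvesSkorohod J (1 - P) x y z) (h' : SolvesSkorohod J (1 - P) x' y' z')
    (h0 : ∀ i, x' 0 i = x 0 i)
    (hx : ∀ i, ∀ s t : ℝ, 0 ≤ s → s ≤ t → x s i - x' s i ≤ x t i - x' t i)
    (i : Fin J) {t : ℝ} (ht : 0 ≤ t) : z' t i ≤ z t i := by
  obtain ⟨σ, hσ0, hσt, hσ⟩ := exists_y_sub_le h h' h0 ht i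
  have h1 := mulVec_mono hP (fun k => monotone_y_sub hP hP0 h h' h0 hx k hσ0 hσt) i
  have h2 : (P *ᵥ fun k => y' t k - y t k) i = (P *ᵥ y' t) i - (P *ᵥ y t) i :=
    congrFun (Matrix.mulVec_sub P (y' t) (y t)) i
  have h3 := h.z_eq ht i
  have h4 := h'.z_eq ht i
  have h5 := hx i σ t hσ0 hσt
  linarith

/-- The regulator is a convex function of the free path. -/
theorem y_sub_div_le (hP : ∀ i k, 0 ≤ P i k)
    (hP0 : ∀ i k, Tendsto (fun n : ℕ => (P ^ n) i k) atTop (𝓝 0)) {u : ℝ → Fin J → ℝ}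
    {yE zE : ℝ → ℝ → Fin J → ℝ} (h : SolvesSkorohod J (1 - P) x y z)
    (hE : ∀ ε > (0 : ℝ),
      SolvesSkorohod J (1 - P) (fun t i => x t i - ε * t * u t i) (yE ε) (zE ε))
    {δ ε : ℝ} (hδ : 0 < δ) (hδε : δ ≤ ε) {t : ℝ} (ht : 0 ≤ t) (i : Fin J) :
    (yE δ t i - y t i) / δ ≤ (yE ε t i - y t i) / ε := by
  have hε : 0 < ε := hδ.trans_le hδε
  set l := δ / ε with hl
  have hl0 : 0 ≤ l := by positivity
  have hl1 : 0 ≤ 1 - l := by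
    rw [sub_nonneg, hl, div_le_one hε]
    exact hδε
  have hlε : l * ε = δ := div_mul_cancel₀ δ hε.ne'
  have hle := y_le_of_feasible hP hP0 (hE δ hδ) (y' := fun t => (1 - l) • y t + l • yE ε t)
    (fun t ht i => add_nonneg (mul_nonneg hl1 (h.y_nonneg ht i))
      (mul_nonneg hl0 ((hE ε hε).y_nonneg ht i)))
    (fun i s t hs hst => add_le_add (mul_le_mul_of_nonneg_left (h.2.2.2.2.2.1 i s t hs hst) hl1)
      (mul_le_mul_of_nonneg_left ((hE ε hε).2.2.2.2.2.1 i s t hs hst) hl0))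
    (fun t ht i => by
      have h1 := mul_nonneg hl1 (h.2.2.2.1 t ht i)
      have h2 := mul_nonneg hl0 ((hE ε hε).2.2.2.1 t ht i)
      rw [h.z_eq ht i] at h1
      rw [(hE ε hε).z_eq ht i] at h2
      simp only [Matrix.mulVec_add, Matrix.mulVec_smul, Pi.add_apply, Pi.smul_apply, smul_eq_mul]
      rw [← hlε]
      linarith) ht i
  simp only [Pi.add_apply, Pi.smul_apply, smul_eq_mul] at hle
  rw [div_le_div_iff₀ hδ hε]
  calc (yE δ t i - y t i) * ε ≤ l * (yE ε t i - y t i) * ε :=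
        mul_le_mul_of_nonneg_right (by linarith) hε.le
    _ = (yE ε t i - y t i) * δ := by rw [mul_right_comm, hlε, mul_comm]

end SolvesSkorohod

/-- A nondecreasing function that is the pointwise limit from above of right-continuous functions
is right-continuous. -/
theorem continuousWithinAt_Ici_of_le_of_tendsto {g : ℝ → ℝ} {B : ℝ → ℝ → ℝ} {t : ℝ}
    (hg : ∀ s, t ≤ s → g t ≤ g s) (hB : ∀ ε > 0, ∀ s, t ≤ s → g s ≤ B ε s)
    (hBc : ∀ ε > 0, ContinuousWithinAt (B ε) (Ici t) t)
    (hlim : Tendsto (fun ε => B ε t) (𝓝[>] 0) (𝓝 (g t))) : ContinuousWithinAt g (Ici t) t := by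
  refine tendsto_order.2 ⟨fun c hc => ?_, fun c hc => ?_⟩
  · filter_upwards [self_mem_nhdsWithin] with s hs using hc.trans_le (hg s hs)
  · obtain ⟨ε, hεc, hε⟩ := ((hlim.eventually_lt_const hc).and self_mem_nhdsWithin).exists
    filter_upwards [(hBc ε hε).eventually_lt_const hεc, self_mem_nhdsWithin] with s hs hts
    exact (hB ε hε s hts).trans_lt hs

/-- A function nondecreasing on `[0,∞)` has left limits on `(0,∞)`. -/
theorem exists_tendsto_nhdsLT_of_monotoneOn {g : ℝ → ℝ} (hg : MonotoneOn g (Ici 0)) {t : ℝ}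
    (ht : 0 < t) : ∃ l, Tendsto g (𝓝[<] t) (𝓝 l) := by
  have hmono : Monotone fun s => g (max s 0) := fun r s hrs =>
    hg (mem_Ici.2 (le_max_right _ _)) (mem_Ici.2 (le_max_right _ _)) (max_le_max_right 0 hrs)
  refine ⟨_, (hmono.tendsto_nhdsLT t).congr' ?_⟩
  filter_upwards [Ioo_mem_nhdsLT ht] with s hs
  rw [max_eq_left hs.1.le]

/-- (Lemmas 5.1 and 5.2.)  Under the hypotheses of Theorem 4.1, every entry `b_i^j` is
nonnegative and nondecreasing in `t`, every entry `a_i^j` is nonnegative, and every entry of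
`a` and of `b` is right-continuous on `[0,∞)` with left limits on `(0,∞)`. -/
theorem derivative_monotone_nonneg_rcll
    (J : ℕ) (P : Matrix (Fin J) (Fin J) ℝ)
    (hPnn : ∀ i k, 0 ≤ P i k) (hPdiag : ∀ i, P i i = 0)
    (hPspec : ∀ μ ∈ spectrum ℂ (P.map (Complex.ofReal ·)), ‖μ‖ < 1)
    (R : Matrix (Fin J) (Fin J) ℝ) (hR : R = 1 - P)
    (x y z : ℝ → Fin J → ℝ) (hx : ∀ i, ContinuousOn (fun t => x t i) (Set.Ici 0))
    (hxyz : SolvesSkorohod J R x y z)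
    (yE zE : ℝ → Fin J → ℝ → Fin J → ℝ)
    (hE : ∀ ε > (0 : ℝ), ∀ j : Fin J,
      SolvesSkorohod J R (fun t i => x t i - ε * t * (if i = j then 1 else 0))
        (yE ε j) (zE ε j))
    (a b : ℝ → Fin J → Fin J → ℝ)
    (ha : ∀ (i j : Fin J), ∀ t ≥ (0 : ℝ),
      Filter.Tendsto (fun ε => (z t i - zE ε j t i) / ε)
        (nhdsWithin 0 (Set.Ioi 0)) (nhds (a t i j)))
    (hb : ∀ (i j : Fin J), ∀ t ≥ (0 : ℝ),
      Filter.Tendsto (fun ε => -((y t i - yE ε j t i) / ε))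
        (nhdsWithin 0 (Set.Ioi 0)) (nhds (b t i j))) :
    (∀ i j, ∀ t ≥ (0 : ℝ), 0 ≤ b t i j) ∧
    (∀ i j, ∀ s t : ℝ, 0 ≤ s → s ≤ t → b s i j ≤ b t i j) ∧
    (∀ i j, ∀ t ≥ (0 : ℝ), 0 ≤ a t i j) ∧
    (∀ i j, ∀ t ≥ (0 : ℝ), ContinuousWithinAt (fun s => a s i j) (Set.Ici t) t ∧
      ContinuousWithinAt (fun s => b s i j) (Set.Ici t) t) ∧
    (∀ i j, ∀ t > (0 : ℝ), (∃ l : ℝ,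
        Filter.Tendsto (fun s => a s i j) (nhdsWithin t (Set.Iio t)) (nhds l)) ∧
      (∃ l : ℝ,
        Filter.Tendsto (fun s => b s i j) (nhdsWithin t (Set.Iio t)) (nhds l))) := by
  subst hR
  have hP0 := tendsto_matrix_pow_apply_zero P hPspec
  have hx0 : ∀ ε : ℝ, ∀ j i : Fin J, x 0 i - ε * 0 * (if i = j then 1 else 0) = x 0 i := by simp
  have hxm : ∀ ε > (0 : ℝ), ∀ j i : Fin J, ∀ s t : ℝ, 0 ≤ s → s ≤ t →
      x s i - (x s i - ε * s * (if i = j then 1 else 0))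
        ≤ x t i - (x t i - ε * t * (if i = j then 1 else 0)) := by
    intro ε hε j i s t _ hst
    rw [sub_sub_cancel, sub_sub_cancel]
    gcongr
  have hb' : ∀ (i j : Fin J), ∀ t ≥ (0 : ℝ),
      Tendsto (fun ε => (yE ε j t i - y t i) / ε) (𝓝[>] 0) (𝓝 (b t i j)) := fun i j t ht =>
    (hb i j t ht).congr fun ε => by rw [← neg_div, neg_sub]
  have hmono : ∀ i j, ∀ s t : ℝ, 0 ≤ s → s ≤ t → b s i j ≤ b t i j := by
    intro i j s t hs hst
    refine le_of_tendsto_of_tendsto (hb' i j s hs) (hb' i j t (hs.trans hst)) ?_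
    filter_upwards [self_mem_nhdsWithin] with ε hε
    exact div_le_div_of_nonneg_right (SolvesSkorohod.monotone_y_sub hPnn hP0 hxyz (hE ε hε j)
      (hx0 ε j) (hxm ε hε j) i hs hst) (le_of_lt hε)
  have hb0 : ∀ i j, b 0 i j = 0 := fun i j =>
    tendsto_nhds_unique_of_eventuallyEq (hb' i j 0 le_rfl) tendsto_const_nhds <| by
      filter_upwards [self_mem_nhdsWithin] with ε hε
      simp [hxyz.2.2.2.2.1 i, (hE ε hε j).2.2.2.2.1 i]
  have hble : ∀ i j, ∀ ε > (0 : ℝ), ∀ t ≥ (0 : ℝ), b t i j ≤ (yE ε j t i - y t i) / ε := by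
    intro i j ε hε t ht
    refine le_of_tendsto (hb' i j t ht) ?_
    filter_upwards [Ioc_mem_nhdsGT hε] with δ hδ
    exact SolvesSkorohod.y_sub_div_le (u := fun _ i => if i = j then 1 else 0) hPnn hP0 hxyz
      (fun ε hε => hE ε hε j) hδ.1 hδ.2 ht i
  have haeq : ∀ i j, ∀ t ≥ (0 : ℝ),
      a t i j = t * (if i = j then 1 else 0) - ∑ k, (1 - P) i k * b t k j := by
    intro i j t ht
    refine tendsto_nhds_unique_of_eventuallyEq (ha i j t ht) (tendsto_const_nhds.sub
      (tendsto_finsetSum Finset.univ fun k _ => (hb' k j t ht).const_mul ((1 - P) i k))) ?_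
    filter_upwards [self_mem_nhdsWithin] with ε hε
    have hε0 : ε ≠ 0 := ne_of_gt hε
    rw [hxyz.2.2.1 t ht i, (hE ε hε j).2.2.1 t ht i]
    simp only [← mul_div_assoc, ← Finset.sum_div, mul_sub, Finset.sum_sub_distrib]
    field_simp
    ring
  have hbc : ∀ i j, ∀ t ≥ (0 : ℝ), ContinuousWithinAt (fun s => b s i j) (Ici t) t := by
    intro i j t ht
    refine continuousWithinAt_Ici_of_le_of_tendsto (B := fun ε s => (yE ε j s i - y s i) / ε)
      (fun s hs => hmono i j t s ht hs) (fun ε hε s hs => hble i j ε hε s (le_trans ht hs))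
      (fun ε hε => ?_) (hb' i j t ht)
    exact ((((hE ε hε j).1 i t ht).sub (hxyz.1 i t ht)).div_const ε).mono (Ici_subset_Ici.2 ht)
  have hbl : ∀ i j, ∀ t > (0 : ℝ), ∃ l, Tendsto (fun s => b s i j) (𝓝[<] t) (𝓝 l) :=
    fun i j t ht => exists_tendsto_nhdsLT_of_monotoneOn
      (fun s hs t _ hst => hmono i j s t hs hst) ht
  refine ⟨fun i j t ht => hb0 i j ▸ hmono i j 0 t le_rfl ht, hmono, fun i j t ht => ?_,
    fun i j t ht => ⟨?_, hbc i j t ht⟩, fun i j t ht => ⟨?_, hbl i j t ht⟩⟩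
  · refine ge_of_tendsto (ha i j t ht) ?_
    filter_upwards [self_mem_nhdsWithin] with ε hε
    exact div_nonneg (sub_nonneg.2 (SolvesSkorohod.z_le_z hPnn hP0 hxyz (hE ε hε j)
      (hx0 ε j) (hxm ε hε j) i ht)) (le_of_lt hε)
  · refine ContinuousWithinAt.congr (f := fun s =>
      s * (if i = j then 1 else 0) - ∑ k, (1 - P) i k * b s k j) ?_
      (fun s hs => haeq i j s (le_trans ht hs)) (haeq i j t ht)
    exact (continuousWithinAt_id.mul_const _).sub
      (tendsto_finsetSum Finset.univ fun k _ => (hbc k j t ht).const_mul _)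
  · choose l hl using fun k => hbl k j t ht
    have hid : Tendsto (fun s : ℝ => s) (𝓝[<] t) (𝓝 t) := tendsto_id.mono_left nhdsWithin_le_nhds
    refine ⟨_, Tendsto.congr' ?_ ((hid.mul_const (if i = j then (1 : ℝ) else 0)).sub
      (tendsto_finsetSum Finset.univ fun k _ => (hl k).const_mul ((1 - P) i k)))⟩
    filter_upwards [Ioo_mem_nhdsLT ht] with s hs
    exact (haeq i j s hs.1.le).symm
end

section
/- (Appendix B: existence and uniqueness of the fixed point of Λ.) Suppose in addition that P̃ has zeros on the diagonal and spectral radius less than one. Then there exists a unique b : [0,∞) → ℝ^{J×J} whose entries are bounded on every compact interval and which satisfies b = Λ(b); moreover every entry of this b is nonnegative and nondecreasing in t. -/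
open Set

/-- The map `Λ` of Appendix B:
`Λ(b)_i^j(t) = sup_{s ∈ [0,t], z_i(s)=0} [χ_i^j(s) + Σ_k P̃_i^k b_k^j(s)]`, `sup ∅ = 0`. -/
noncomputable def Lam (J : ℕ) (Pt : Matrix (Fin J) (Fin J) ℝ)
    (z : ℝ → Fin J → ℝ) (χ : ℝ → Fin J → Fin J → ℝ)
    (b : ℝ → Fin J → Fin J → ℝ) : ℝ → Fin J → Fin J → ℝ :=
  fun t i j =>
    sSup ((fun s => χ s i j + ∑ k, Pt i k * b s k j) '' {s | s ∈ Set.Icc 0 t ∧ z s i = 0})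

section GeometricSeries

open scoped Matrix

theorem summable_pow_of_spectralRadius_lt_one {A : Type*} [NormedRing A] [NormedAlgebra ℂ A]
    [CompleteSpace A] {a : A} (ha : spectralRadius ℂ a < 1) : Summable (fun n : ℕ => a ^ n) := by
  obtain ⟨r, hr1, hr⟩ := ENNReal.lt_iff_exists_nnreal_btwn.mp (ENNReal.one_lt_inv.mpr ha)
  have hr_pos : 0 < r := zero_lt_one.trans (by exact_mod_cast hr1)
  have hdiff := (spectrum.differentiableOn_inverse_one_sub_smul hr).hasFPowerSeriesOnBall hr_pos
  have hseries := (spectrum.hasFPowerSeriesOnBall_inverse_one_sub_smul ℂ a).exchange_radius hdiff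
  have hmem : (1 : ℂ) ∈ Metric.eball (0 : ℂ) r := by
    simpa [Metric.mem_eball, edist_zero_right] using hr1
  simpa using (hseries.hasSum hmem).summable

attribute [local instance] Matrix.linftyOpNormedRing Matrix.linftyOpNormedAlgebra

theorem Matrix.summable_pow_of_forall_spectrum_norm_lt_one {n : Type*} [Fintype n]
    [DecidableEq n] [Nonempty n] (P : Matrix n n ℝ)
    (hP : ∀ μ ∈ spectrum ℂ (P.map (Complex.ofReal ·)), ‖μ‖ < 1) :
    Summable (fun m : ℕ => P ^ m) := by
  have hcomplete : CompleteSpace (Matrix n n ℂ) := FiniteDimensional.complete ℂ _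
  have hrad : spectralRadius ℂ (P.map (Complex.ofReal ·)) < 1 := by
    simpa using spectrum.spectralRadius_lt_of_forall_lt (P.map (Complex.ofReal ·)) (r := 1)
      (fun μ hμ => by exact_mod_cast hP μ hμ)
  have hsum := summable_pow_of_spectralRadius_lt_one hrad
  have hpow (m : ℕ) : (P.map (Complex.ofReal ·)) ^ m = (P ^ m).map (Complex.ofReal ·) :=
    (map_pow Complex.ofRealHom.mapMatrix P m).symm
  have hre : Continuous fun M : Matrix n n ℂ => M.map Complex.re :=
    continuous_id.matrix_map Complex.continuous_re
  have h := hsum.map (Complex.reLm.toAddMonoidHom.mapMatrix (m := n) (n := n)) hre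
  refine h.congr fun m => ?_
  ext i j
  simp [hpow]

/-- The vector `u` is the image of the constant vector `1` under the Neumann series of `P`. -/
theorem Matrix.exists_nonneg_eq_one_add_mulVec {n : Type*} [Fintype n]
    [DecidableEq n] {P : Matrix n n ℝ} (hP : ∀ i k, 0 ≤ P i k)
    (hsum : Summable (fun m : ℕ => P ^ m)) :
    ∃ u : n → ℝ, (∀ i, 0 ≤ u i) ∧ ∀ i, u i = 1 + ∑ k, P i k * u k := by
  have hnn (m : ℕ) (i k : n) : 0 ≤ (P ^ m) i k := by
    induction m generalizing i k with
    | zero => rw [pow_zero, Matrix.one_apply]; split_ifs <;> norm_num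
    | succ m ih =>
      rw [pow_succ, Matrix.mul_apply]
      exact Finset.sum_nonneg fun l _ => mul_nonneg (ih i l) (hP l k)
  refine ⟨(∑' m : ℕ, P ^ m) *ᵥ 1, fun i => ?_, fun i => ?_⟩
  · refine Finset.sum_nonneg fun k _ => mul_nonneg ?_ zero_le_one
    have h : HasSum (fun m : ℕ => (P ^ m) i k) ((∑' m : ℕ, P ^ m) i k) :=
      Pi.hasSum.mp (Pi.hasSum.mp hsum.hasSum i) k
    exact h.nonneg fun m => hnn m i k
  · have h := congrArg (fun M => (M *ᵥ (1 : n → ℝ)) i) hsum.one_sub_mul_tsum_pow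
    simp only [Matrix.sub_mul, Matrix.sub_mulVec, Matrix.one_mul, ← Matrix.mulVec_mulVec,
      Pi.sub_apply, Matrix.one_mulVec, Pi.one_apply] at h
    have h' : (P *ᵥ ((∑' m : ℕ, P ^ m) *ᵥ (1 : n → ℝ))) i =
      ∑ k, P i k * ((∑' m : ℕ, P ^ m) *ᵥ (1 : n → ℝ)) k := rfl
    linarith

end GeometricSeries

theorem Real.sSup_image_le_sSup_image_add {α : Type*} {S : Set α} {f g : α → ℝ} {ε : ℝ}
    (hε : 0 ≤ ε) (hfg : ∀ s ∈ S, f s ≤ g s + ε) (hg : BddAbove (g '' S)) :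
    sSup (f '' S) ≤ sSup (g '' S) + ε := by
  rcases S.eq_empty_or_nonempty with rfl | hS
  · simpa using hε
  · refine csSup_le (hS.image f) ?_
    rintro _ ⟨s, hs, rfl⟩
    exact (hfg s hs).trans (by gcongr; exact le_csSup hg (mem_image_of_mem g hs))

section Lam

variable {J : ℕ} {Pt : Matrix (Fin J) (Fin J) ℝ} {z : ℝ → Fin J → ℝ}
  {χ b b' : ℝ → Fin J → Fin J → ℝ} {t : ℝ} {i j : Fin J}

theorem Lam_nonneg (hP : ∀ i k, 0 ≤ Pt i k) (hχ : ∀ t ≥ (0 : ℝ), ∀ i j, 0 ≤ χ t i j)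
    (hb : ∀ t ≥ (0 : ℝ), ∀ i j, 0 ≤ b t i j) : 0 ≤ Lam J Pt z χ b t i j := by
  refine Real.sSup_nonneg ?_
  rintro _ ⟨s, ⟨hs, -⟩, rfl⟩
  exact add_nonneg (hχ s hs.1 i j)
    (Finset.sum_nonneg fun k _ => mul_nonneg (hP i k) (hb s hs.1 k j))

theorem Lam_le {C : ℝ} (hC : 0 ≤ C)
    (h : ∀ s ∈ Icc 0 t, z s i = 0 → χ s i j + ∑ k, Pt i k * b s k j ≤ C) :
    Lam J Pt z χ b t i j ≤ C := by
  refine Real.sSup_le ?_ hC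
  rintro _ ⟨s, ⟨hs, hz⟩, rfl⟩
  exact h s hs hz

theorem bddAbove_Lam_image (hP : ∀ i k, 0 ≤ Pt i k)
    (hχ : ∀ i j, ∀ s t : ℝ, 0 ≤ s → s ≤ t → χ s i j ≤ χ t i j)
    (hb : ∃ M : ℝ, ∀ s ∈ Icc 0 t, ∀ i j, |b s i j| ≤ M) :
    BddAbove ((fun s => χ s i j + ∑ k, Pt i k * b s k j) ''
      {s | s ∈ Icc 0 t ∧ z s i = 0}) := by
  obtain ⟨M, hM⟩ := hb
  refine ⟨χ t i j + ∑ k, Pt i k * M, ?_⟩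
  rintro _ ⟨s, ⟨hs, -⟩, rfl⟩
  exact add_le_add (hχ i j s t hs.1 hs.2) (Finset.sum_le_sum fun k _ =>
    mul_le_mul_of_nonneg_left ((le_abs_self _).trans (hM s hs k j)) (hP i k))

theorem Lam_mono (hP : ∀ i k, 0 ≤ Pt i k)
    (hχ : ∀ i j, ∀ s t : ℝ, 0 ≤ s → s ≤ t → χ s i j ≤ χ t i j)
    (hb' : ∃ M : ℝ, ∀ s ∈ Icc 0 t, ∀ i j, |b' s i j| ≤ M)
    (h : ∀ t ≥ (0 : ℝ), ∀ i j, b t i j ≤ b' t i j) :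
    Lam J Pt z χ b t i j ≤ Lam J Pt z χ b' t i j := by
  refine (Real.sSup_image_le_sSup_image_add le_rfl (fun s hs => ?_)
    (bddAbove_Lam_image hP hχ hb')).trans_eq (add_zero _)
  rw [add_zero]
  exact add_le_add le_rfl (Finset.sum_le_sum fun k _ =>
    mul_le_mul_of_nonneg_left (h s hs.1.1 k j) (hP i k))

theorem abs_Lam_sub_Lam_le (hP : ∀ i k, 0 ≤ Pt i k)
    (hχ : ∀ i j, ∀ s t : ℝ, 0 ≤ s → s ≤ t → χ s i j ≤ χ t i j)
    (hb : ∃ M : ℝ, ∀ s ∈ Icc 0 t, ∀ i j, |b s i j| ≤ M)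
    (hb' : ∃ M : ℝ, ∀ s ∈ Icc 0 t, ∀ i j, |b' s i j| ≤ M)
    {v : Fin J → ℝ} (hv : ∀ i, 0 ≤ v i)
    (h : ∀ s ∈ Icc 0 t, ∀ i j, |b s i j - b' s i j| ≤ v i) :
    |Lam J Pt z χ b t i j - Lam J Pt z χ b' t i j| ≤ ∑ k, Pt i k * v k := by
  have hε : 0 ≤ ∑ k, Pt i k * v k := Finset.sum_nonneg fun k _ => mul_nonneg (hP i k) (hv k)
  have key {c c' : ℝ → Fin J → Fin J → ℝ} (hc' : ∃ M : ℝ, ∀ s ∈ Icc 0 t, ∀ i j, |c' s i j| ≤ M)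
      (hcc' : ∀ s ∈ Icc 0 t, ∀ i j, c s i j ≤ c' s i j + v i) :
      Lam J Pt z χ c t i j ≤ Lam J Pt z χ c' t i j + ∑ k, Pt i k * v k := by
    refine Real.sSup_image_le_sSup_image_add hε (fun s hs => ?_) (bddAbove_Lam_image hP hχ hc')
    rw [add_assoc, ← Finset.sum_add_distrib]
    refine add_le_add le_rfl (Finset.sum_le_sum fun k _ => ?_)
    rw [← mul_add]
    exact mul_le_mul_of_nonneg_left (hcc' s hs.1 k j) (hP i k)
  rw [abs_sub_le_iff]
  constructor
  · linarith [key (c := b) hb' fun s hs i j => by linarith [(abs_sub_le_iff.mp (h s hs i j)).1]]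
  · linarith [key (c := b') hb fun s hs i j => by linarith [(abs_sub_le_iff.mp (h s hs i j)).2]]

theorem Lam_fixed_point_unique (hP : ∀ i k, 0 ≤ Pt i k)
    (hχ : ∀ i j, ∀ s t : ℝ, 0 ≤ s → s ≤ t → χ s i j ≤ χ t i j)
    {u : Fin J → ℝ} (hu_nonneg : ∀ i, 0 ≤ u i) (hu : ∀ i, u i = 1 + ∑ k, Pt i k * u k)
    (hb : ∀ T ≥ (0 : ℝ), ∃ M : ℝ, ∀ t ∈ Icc (0 : ℝ) T, ∀ i j, |b t i j| ≤ M)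
    (hb_fix : ∀ t ≥ (0 : ℝ), ∀ i j, b t i j = Lam J Pt z χ b t i j)
    (hb' : ∀ T ≥ (0 : ℝ), ∃ M : ℝ, ∀ t ∈ Icc (0 : ℝ) T, ∀ i j, |b' t i j| ≤ M)
    (hb'_fix : ∀ t ≥ (0 : ℝ), ∀ i j, b' t i j = Lam J Pt z χ b' t i j)
    (ht : 0 ≤ t) : b' t i j = b t i j := by
  have hPu_nonneg (i : Fin J) : 0 ≤ ∑ k, Pt i k * u k :=
    Finset.sum_nonneg fun k _ => mul_nonneg (hP i k) (hu_nonneg k)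
  have hu_one (i : Fin J) : 1 ≤ u i := by linarith [hu i, hPu_nonneg i]
  set U := 1 + ∑ i, u i with hU
  have hU_one : 1 ≤ U := by linarith [Finset.sum_nonneg fun i (_ : i ∈ Finset.univ) => hu_nonneg i]
  have hU_pos : 0 < U := by linarith
  have hu_le (i : Fin J) : u i ≤ U := by
    linarith [Finset.single_le_sum (fun k _ => hu_nonneg k) (Finset.mem_univ i)]
  set c := 1 - U⁻¹ with hc
  have hc_nonneg : 0 ≤ c := sub_nonneg.mpr (inv_le_one_of_one_le₀ hU_one)
  have hc_lt : c < 1 := sub_lt_self 1 (inv_pos.mpr hU_pos)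
  have hPu (i : Fin J) : ∑ k, Pt i k * u k ≤ c * u i := by
    have : U⁻¹ * u i ≤ 1 := inv_mul_le_one_of_le₀ (hu_le i) hU_pos.le
    rw [hc, sub_mul]
    linarith [hu i]
  obtain ⟨M, hM⟩ := hb t ht
  obtain ⟨M', hM'⟩ := hb' t ht
  have hD_nonneg : 0 ≤ M' + M :=
    add_nonneg ((abs_nonneg _).trans (hM' t ⟨ht, le_rfl⟩ i j))
      ((abs_nonneg _).trans (hM t ⟨ht, le_rfl⟩ i j))
  have hdiff (n : ℕ) : ∀ s ∈ Icc 0 t, ∀ i j,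
      |b' s i j - b s i j| ≤ (M' + M) * c ^ n * u i := by
    induction n with
    | zero =>
      intro s hs i j
      rw [pow_zero, mul_one]
      exact ((abs_sub _ _).trans (add_le_add (hM' s hs i j) (hM s hs i j))).trans
        (le_mul_of_one_le_right hD_nonneg (hu_one i))
    | succ n ih =>
      intro s hs i j
      rw [hb'_fix s hs.1, hb_fix s hs.1]
      refine (abs_Lam_sub_Lam_le hP hχ (hb' s hs.1) (hb s hs.1)
        (v := fun k => (M' + M) * c ^ n * u k) (fun k => by have := hu_nonneg k; positivity)
        fun r hr => ih r ⟨hr.1, hr.2.trans hs.2⟩).trans ?_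
      calc ∑ k, Pt i k * ((M' + M) * c ^ n * u k)
          = (M' + M) * c ^ n * ∑ k, Pt i k * u k := by
            rw [Finset.mul_sum]; exact Finset.sum_congr rfl fun k _ => by ring
        _ ≤ (M' + M) * c ^ n * (c * u i) := by have := hPu i; gcongr
        _ = (M' + M) * c ^ (n + 1) * u i := by ring
  have hlim : Filter.Tendsto (fun n : ℕ => (M' + M) * c ^ n * u i) Filter.atTop (nhds 0) := by
    simpa using ((tendsto_pow_atTop_nhds_zero_of_lt_one hc_nonneg hc_lt).const_mul
      (M' + M)).mul_const (u i)
  have hzero : |b' t i j - b t i j| ≤ 0 :=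
    ge_of_tendsto' hlim fun n => hdiff n t ⟨ht, le_rfl⟩ i j
  exact sub_eq_zero.mp (abs_nonpos_iff.mp hzero)

/-- The fixed point is the limit of the increasing iterates of `Λ` started at zero, which stay
below a multiple of `u`. -/
theorem exists_Lam_fixed_point (hP : ∀ i k, 0 ≤ Pt i k)
    (hχ_nonneg : ∀ t ≥ (0 : ℝ), ∀ i j, 0 ≤ χ t i j)
    (hχ : ∀ i j, ∀ s t : ℝ, 0 ≤ s → s ≤ t → χ s i j ≤ χ t i j)
    {u : Fin J → ℝ} (hu_nonneg : ∀ i, 0 ≤ u i) (hu : ∀ i, u i = 1 + ∑ k, Pt i k * u k) :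
    ∃ b : ℝ → Fin J → Fin J → ℝ,
      (∀ T ≥ (0 : ℝ), ∃ M : ℝ, ∀ t ∈ Icc (0 : ℝ) T, ∀ i j, |b t i j| ≤ M) ∧
      (∀ t ≥ (0 : ℝ), ∀ i j, b t i j = Lam J Pt z χ b t i j) ∧
      (∀ t ≥ (0 : ℝ), ∀ i j, 0 ≤ b t i j) := by
  set K : ℝ → Fin J → ℝ := fun t j => ∑ i, χ t i j
  have hK_nonneg {t : ℝ} (ht : 0 ≤ t) (j : Fin J) : 0 ≤ K t j :=
    Finset.sum_nonneg fun i _ => hχ_nonneg t ht i j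
  have hK_mono {s t : ℝ} (hs : 0 ≤ s) (hst : s ≤ t) (j : Fin J) : K s j ≤ K t j :=
    Finset.sum_le_sum fun i _ => hχ i j s t hs hst
  have hχ_le {t : ℝ} (ht : 0 ≤ t) (i j : Fin J) : χ t i j ≤ K t j :=
    Finset.single_le_sum (f := fun i => χ t i j) (fun k _ => hχ_nonneg t ht k j)
      (Finset.mem_univ i)
  have hbounded {b : ℝ → Fin J → Fin J → ℝ} (hb : ∀ t ≥ (0 : ℝ), ∀ i j, 0 ≤ b t i j)
      (hbu : ∀ t ≥ (0 : ℝ), ∀ i j, b t i j ≤ K t j * u i) (T : ℝ) :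
      ∃ M : ℝ, ∀ t ∈ Icc (0 : ℝ) T, ∀ i j, |b t i j| ≤ M := by
    refine ⟨∑ i, ∑ j, K T j * u i, fun t ht i j => ?_⟩
    have hT : 0 ≤ T := ht.1.trans ht.2
    have hterm (i j : Fin J) : 0 ≤ K T j * u i := mul_nonneg (hK_nonneg hT j) (hu_nonneg i)
    rw [abs_of_nonneg (hb t ht.1 i j)]
    calc b t i j ≤ K t j * u i := hbu t ht.1 i j
      _ ≤ K T j * u i := mul_le_mul_of_nonneg_right (hK_mono ht.1 ht.2 j) (hu_nonneg i)
      _ ≤ ∑ j, K T j * u i :=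
        Finset.single_le_sum (f := fun j => K T j * u i) (fun j _ => hterm i j)
          (Finset.mem_univ j)
      _ ≤ ∑ i, ∑ j, K T j * u i :=
        Finset.single_le_sum (f := fun i => ∑ j, K T j * u i)
          (fun i _ => Finset.sum_nonneg fun j _ => hterm i j) (Finset.mem_univ i)
  set B : ℕ → ℝ → Fin J → Fin J → ℝ := fun n => (Lam J Pt z χ)^[n] 0
  have hB_succ (n : ℕ) : B (n + 1) = Lam J Pt z χ (B n) := Function.iterate_succ_apply' _ _ _
  have hB_nonneg (n : ℕ) : ∀ t ≥ (0 : ℝ), ∀ i j, 0 ≤ B n t i j := by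
    induction n with
    | zero => exact fun t _ i j => le_rfl
    | succ n ih => rw [hB_succ]; exact fun t _ i j => Lam_nonneg hP hχ_nonneg ih
  have hB_le (n : ℕ) : ∀ t ≥ (0 : ℝ), ∀ i j, B n t i j ≤ K t j * u i := by
    induction n with
    | zero => exact fun t ht i j => mul_nonneg (hK_nonneg ht j) (hu_nonneg i)
    | succ n ih =>
      rw [hB_succ]
      refine fun t ht i j => Lam_le (mul_nonneg (hK_nonneg ht j) (hu_nonneg i)) fun s hs _ => ?_
      calc χ s i j + ∑ k, Pt i k * B n s k j
          ≤ K s j + ∑ k, Pt i k * (K s j * u k) :=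
            add_le_add (hχ_le hs.1 i j) (Finset.sum_le_sum fun k _ =>
              mul_le_mul_of_nonneg_left (ih s hs.1 k j) (hP i k))
        _ = K s j * u i := by
          rw [hu i, mul_add, mul_one, Finset.mul_sum]
          congr 1
          exact Finset.sum_congr rfl fun k _ => by ring
        _ ≤ K t j * u i := mul_le_mul_of_nonneg_right (hK_mono hs.1 hs.2 j) (hu_nonneg i)
  have hB_le_succ (n : ℕ) : ∀ t ≥ (0 : ℝ), ∀ i j, B n t i j ≤ B (n + 1) t i j := by
    induction n with
    | zero => exact hB_nonneg 1
    | succ n ih =>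
      intro t _ i j
      rw [hB_succ (n + 1), hB_succ n]
      refine Lam_mono hP hχ (hbounded ?_ ?_ t) ?_
      · rw [← hB_succ]; exact hB_nonneg _
      · rw [← hB_succ]; exact hB_le _
      · rw [← hB_succ]; exact ih
  set b : ℝ → Fin J → Fin J → ℝ := fun t i j => ⨆ n, B n t i j
  have hB_bdd {t : ℝ} (ht : 0 ≤ t) (i j : Fin J) : BddAbove (range fun n => B n t i j) :=
    ⟨K t j * u i, by rintro _ ⟨n, rfl⟩; exact hB_le n t ht i j⟩
  have hB_le_b (n : ℕ) : ∀ t ≥ (0 : ℝ), ∀ i j, B n t i j ≤ b t i j :=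
    fun t ht i j => le_ciSup (hB_bdd ht i j) n
  have hB_lim {t : ℝ} (ht : 0 ≤ t) (i j : Fin J) :
      Filter.Tendsto (fun n => B n t i j) Filter.atTop (nhds (b t i j)) :=
    tendsto_atTop_ciSup (monotone_nat_of_le_succ fun n => hB_le_succ n t ht i j) (hB_bdd ht i j)
  have hb_nonneg : ∀ t ≥ (0 : ℝ), ∀ i j, 0 ≤ b t i j := hB_le_b 0
  have hb_bounded := hbounded hb_nonneg fun t ht i j => ciSup_le fun n => hB_le n t ht i j
  refine ⟨b, fun T _ => hb_bounded T, fun t ht i j => le_antisymm ?_ ?_, hb_nonneg⟩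
  · refine ciSup_le fun n => (hB_le_succ n t ht i j).trans ?_
    rw [hB_succ]
    exact Lam_mono hP hχ (hb_bounded t) (hB_le_b n)
  · refine Lam_le (hb_nonneg t ht i j) fun s hs hz => ?_
    have hlim : Filter.Tendsto (fun n => χ s i j + ∑ k, Pt i k * B n s k j) Filter.atTop
        (nhds (χ s i j + ∑ k, Pt i k * b s k j)) :=
      (tendsto_finsetSum _ fun k _ => (hB_lim hs.1 k j).const_mul _).const_add _
    refine le_of_tendsto' hlim fun n => le_trans ?_ (hB_le_b (n + 1) t ht i j)
    rw [hB_succ]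
    exact le_csSup (bddAbove_Lam_image hP hχ (hbounded (hB_nonneg n) (hB_le n) t))
      (mem_image_of_mem _ ⟨hs, hz⟩)

theorem Lam_le_Lam_of_le (hP : ∀ i k, 0 ≤ Pt i k)
    (hχ_nonneg : ∀ t ≥ (0 : ℝ), ∀ i j, 0 ≤ χ t i j)
    (hχ : ∀ i j, ∀ s t : ℝ, 0 ≤ s → s ≤ t → χ s i j ≤ χ t i j)
    (hb_nonneg : ∀ t ≥ (0 : ℝ), ∀ i j, 0 ≤ b t i j)
    (hb : ∃ M : ℝ, ∀ s ∈ Icc 0 t, ∀ i j, |b s i j| ≤ M) {s : ℝ} (hst : s ≤ t) :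
    Lam J Pt z χ b s i j ≤ Lam J Pt z χ b t i j :=
  Lam_le (Lam_nonneg hP hχ_nonneg hb_nonneg) fun _ hr hz =>
    le_csSup (bddAbove_Lam_image hP hχ hb) (mem_image_of_mem _ ⟨⟨hr.1, hr.2.trans hst⟩, hz⟩)

end Lam

/-- (Appendix B: existence and uniqueness of the fixed point of `Λ`.)  If in addition `P̃` has
zeros on the diagonal and spectral radius less than one, then there exists a unique
`b : [0,∞) → ℝ^{J×J}` with entries bounded on every compact interval satisfying `b = Λ(b)`;
moreover every entry of this `b` is nonnegative and nondecreasing in `t`. -/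
theorem Lam_fixed_point_exists_unique
    (J : ℕ) (hJ : 1 ≤ J)
    (Pt : Matrix (Fin J) (Fin J) ℝ) (hPtnn : ∀ i k, 0 ≤ Pt i k)
    (hPtdiag : ∀ i, Pt i i = 0)
    (hPtspec : ∀ μ ∈ spectrum ℂ (Pt.map (Complex.ofReal ·)), ‖μ‖ < 1)
    (z : ℝ → Fin J → ℝ) (hzc : ∀ i, ContinuousOn (fun t => z t i) (Set.Ici 0))
    (hznn : ∀ t ≥ (0 : ℝ), ∀ i, 0 ≤ z t i)
    (χ : ℝ → Fin J → Fin J → ℝ)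
    (hχc : ∀ i j, ContinuousOn (fun t => χ t i j) (Set.Ici 0))
    (hχnn : ∀ t ≥ (0 : ℝ), ∀ i j, 0 ≤ χ t i j)
    (hχmono : ∀ i j, ∀ s t : ℝ, 0 ≤ s → s ≤ t → χ s i j ≤ χ t i j) :
    ∃ b : ℝ → Fin J → Fin J → ℝ,
      ((∀ T ≥ (0 : ℝ), ∃ M : ℝ, ∀ t ∈ Set.Icc (0 : ℝ) T, ∀ i j, |b t i j| ≤ M) ∧
       (∀ t ≥ (0 : ℝ), ∀ i j, b t i j = Lam J Pt z χ b t i j) ∧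
       (∀ t ≥ (0 : ℝ), ∀ i j, 0 ≤ b t i j) ∧
       (∀ i j, ∀ s t : ℝ, 0 ≤ s → s ≤ t → b s i j ≤ b t i j)) ∧
      (∀ b' : ℝ → Fin J → Fin J → ℝ,
        (∀ T ≥ (0 : ℝ), ∃ M : ℝ, ∀ t ∈ Set.Icc (0 : ℝ) T, ∀ i j, |b' t i j| ≤ M) →
        (∀ t ≥ (0 : ℝ), ∀ i j, b' t i j = Lam J Pt z χ b' t i j) →
        (∀ t ≥ (0 : ℝ), ∀ i j, b' t i j = b t i j)) := by
  have : Nonempty (Fin J) := ⟨⟨0, hJ⟩⟩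
  obtain ⟨u, hu_nonneg, hu⟩ := Matrix.exists_nonneg_eq_one_add_mulVec hPtnn
    (Pt.summable_pow_of_forall_spectrum_norm_lt_one hPtspec)
  obtain ⟨b, hb, hb_fix, hb_nonneg⟩ :=
    exists_Lam_fixed_point (z := z) hPtnn hχnn hχmono hu_nonneg hu
  refine ⟨b, ⟨hb, hb_fix, hb_nonneg, fun i j s t hs hst => ?_⟩, fun b' hb' hb'_fix t ht i j =>
    Lam_fixed_point_unique hPtnn hχmono hu_nonneg hu hb hb_fix hb' hb'_fix ht⟩
  rw [hb_fix s hs, hb_fix t (hs.trans hst)]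
  exact Lam_le_Lam_of_le hPtnn hχnn hχmono hb_nonneg (hb t (hs.trans hst)) hst
end
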